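/- Let $f\in W^{1,1}(\mathbb{S}^d)$ and $\{f_j\}_{j\in\mathbb{N}}\subset W^{1,1}(\mathbb{S}^d)$ be such that $\|f-f_j\|_{W^{1,1}(\mathbb{S}^d)}\to 0$ as $j\to\infty$. Then $\||f_j|-|f|\|_{W^{1,1}(\mathbb{S}^d)}\to 0$ as $j\to\infty$. -/

import Mathlib

open MeasureTheory Metric Filter Topology Asymptotics
open scoped ENNReal RealInnerProductSpace NNReal

noncomputable section

/-- Euclidean space `ℝⁿ`. -/
abbrev Euc (n : ℕ) : Type := EuclideanSpace ℝ (Fin n)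

/-- The unit sphere `𝕊^d ⊆ ℝ^(d+1)`. -/
abbrev Sph (d : ℕ) : Type := Metric.sphere (0 : Euc (d + 1)) 1

/-- The north pole `𝐞 = (1,0,…,0)`. -/
def npole (d : ℕ) : Sph d :=
  ⟨EuclideanSpace.single 0 1, by
    rw [mem_sphere_zero_iff_norm, EuclideanSpace.norm_single]; norm_num⟩

/-- The south pole `-𝐞`. -/
def spole (d : ℕ) : Sph d :=
  ⟨-(npole d : Euc (d + 1)), by
    rw [mem_sphere_zero_iff_norm, norm_neg, ← mem_sphere_zero_iff_norm]
    exact (npole d).2⟩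

/-- Geodesic distance on the sphere. -/
def geodist {d : ℕ} (ξ η : Sph d) : ℝ :=
  Real.arccos ⟪(ξ : Euc (d + 1)), (η : Euc (d + 1))⟫

/-- Open geodesic ball. -/
def gball {d : ℕ} (ζ : Sph d) (r : ℝ) : Set (Sph d) := {η | geodist ζ η < r}

/-- Closed geodesic ball. -/
def gcball {d : ℕ} (ζ : Sph d) (r : ℝ) : Set (Sph d) := {η | geodist ζ η ≤ r}

/-- Geodesic sphere (boundary of a geodesic ball). -/
def gsphere {d : ℕ} (ζ : Sph d) (r : ℝ) : Set (Sph d) := {η | geodist ζ η = r}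

/-- The surface measure `σ` on `𝕊^d`, as the `d`-dimensional Hausdorff measure. -/
def sphMeasure (d : ℕ) : Measure (Sph d) :=
  Measure.comap Subtype.val (MeasureTheory.Measure.hausdorffMeasure (d : ℝ))

/-- The `(d-1)`-dimensional Hausdorff measure on `𝕊^d` (surface measure of boundaries of
geodesic balls). -/
def sphBdry (d : ℕ) : Measure (Sph d) :=
  Measure.comap Subtype.val (MeasureTheory.Measure.hausdorffMeasure ((d : ℝ) - 1))

/-- Polar angle `θ(ξ) = d(𝐞, ξ)`. -/
def polarAngle {d : ℕ} (ξ : Sph d) : ℝ := geodist (npole d) ξ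

/-- `w(ξ) = min{θ(ξ), π - θ(ξ)}`. -/
def sphWidth {d : ℕ} (ξ : Sph d) : ℝ := min (polarAngle ξ) (Real.pi - polarAngle ξ)

/-- A function on the sphere is polar if it only depends on `ξ ⬝ 𝐞`. -/
def IsPolar {d : ℕ} (f : Sph d → ℝ) : Prop :=
  ∀ ξ η : Sph d,
    ⟪(ξ : Euc (d + 1)), (npole d : Euc (d + 1))⟫ =
      ⟪(η : Euc (d + 1)), (npole d : Euc (d + 1))⟫ → f ξ = f η

/-- The uncentered fractional Hardy–Littlewood maximal function `𝓜̃_β f` on `𝕊^d`. -/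
def sphMax {d : ℕ} (β : ℝ) (f : Sph d → ℝ) (ξ : Sph d) : ℝ :=
  sSup {a | ∃ ζ : Sph d, ∃ r : ℝ, 0 < r ∧ r ≤ Real.pi ∧ geodist ζ ξ ≤ r ∧
    a = r ^ β * ⨍ η in gball ζ r, |f η| ∂(sphMeasure d)}

/-- The closed ball `B̄(ζ,r)` is a best ball for `𝓜̃_β f` at `ξ`, i.e. it contains `ξ` and
realizes the supremum defining `𝓜̃_β f (ξ)`. -/
def IsBestBall {d : ℕ} (β : ℝ) (f : Sph d → ℝ) (ξ ζ : Sph d) (r : ℝ) : Prop :=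
  0 ≤ r ∧ r ≤ Real.pi ∧ geodist ζ ξ ≤ r ∧
    sphMax β f ξ = r ^ β * ⨍ η in gball ζ r, |f η| ∂(sphMeasure d)

/-- Projection onto the tangent space of the sphere at `η`. -/
def tangProj {d : ℕ} (η : Sph d) (v : Euc (d + 1)) : Euc (d + 1) :=
  v - ⟪v, (η : Euc (d + 1))⟫ • (η : Euc (d + 1))

/-- `g` is the weak (tangential) gradient of `f` on `𝕊^d`: `g` is a.e. tangent and the
integration-by-parts formula against restrictions of smooth test functions holds. -/
def HasWeakGrad {d : ℕ} (f : Sph d → ℝ) (g : Sph d → Euc (d + 1)) : Prop :=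
  (∀ᵐ η ∂(sphMeasure d), ⟪g η, (η : Euc (d + 1))⟫ = 0) ∧
  ∀ φ : Euc (d + 1) → ℝ, ContDiff ℝ (⊤ : ℕ∞) φ →
    ∫ η, φ (η : Euc (d + 1)) • g η ∂(sphMeasure d)
      = - ∫ η, f η • tangProj η (gradient φ (η : Euc (d + 1))) ∂(sphMeasure d)
        + (d : ℝ) • ∫ η, (f η * φ (η : Euc (d + 1))) • (η : Euc (d + 1)) ∂(sphMeasure d)

/-- `f ∈ W^{1,1}(𝕊^d)`, with weak gradient `g`. -/
def MemW11 {d : ℕ} (f : Sph d → ℝ) (g : Sph d → Euc (d + 1)) : Prop :=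
  Integrable f (sphMeasure d) ∧ Integrable g (sphMeasure d) ∧ HasWeakGrad f g

/-- Convergence `f_j → f` in `W^{1,1}(𝕊^d)` (with weak gradients `g_j, g`). -/
def W11Tendsto {d : ℕ} (fj : ℕ → Sph d → ℝ) (gj : ℕ → Sph d → Euc (d + 1))
    (f : Sph d → ℝ) (g : Sph d → Euc (d + 1)) : Prop :=
  Tendsto (fun j => (∫ ξ, |fj j ξ - f ξ| ∂(sphMeasure d)) +
    ∫ ξ, ‖gj j ξ - g ξ‖ ∂(sphMeasure d)) atTop (nhds 0)

/-- `u : 𝕊^d → ℝ` is differentiable at `ξ` with (tangential) gradient `G`. -/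
def HasSphereGradAt {d : ℕ} (u : Sph d → ℝ) (G : Euc (d + 1)) (ξ : Sph d) : Prop :=
  ⟪G, (ξ : Euc (d + 1))⟫ = 0 ∧
    (fun η : Sph d => u η - u ξ - ⟪G, (η : Euc (d + 1)) - (ξ : Euc (d + 1))⟫)
      =o[nhds ξ] (fun η : Sph d => dist η ξ)

/-- The unit tangent vector at `η` pointing in the direction of the geodesic from `η` to `ζ`:
`v(η,ζ) = (ζ - (η·ζ)η)/|ζ - (η·ζ)η|`. -/
def gdir {d : ℕ} (η ζ : Sph d) : Euc (d + 1) :=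
  ‖(ζ : Euc (d + 1)) - ⟪(η : Euc (d + 1)), (ζ : Euc (d + 1))⟫ • (η : Euc (d + 1))‖⁻¹ •
    ((ζ : Euc (d + 1)) - ⟪(η : Euc (d + 1)), (ζ : Euc (d + 1))⟫ • (η : Euc (d + 1)))

/-- `S(η) = (η·v(ξ,𝐞))ξ - (η·ξ)v(ξ,𝐞)`. -/
def Svec {d : ℕ} (ξ η : Sph d) : Euc (d + 1) :=
  ⟪(η : Euc (d + 1)), gdir ξ (npole d)⟫ • (ξ : Euc (d + 1)) -
    ⟪(η : Euc (d + 1)), (ξ : Euc (d + 1))⟫ • gdir ξ (npole d)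

/-- `ζ` lies on the (closed) half great circle determined by `𝐞`, `ξ` and `-𝐞`
(the one passing through `ξ`). -/
def OnHalfGreatCircle {d : ℕ} (ξ ζ : Sph d) : Prop :=
  ∃ a b : ℝ, 0 ≤ b ∧ (ζ : Euc (d + 1)) = a • (npole d : Euc (d + 1)) +
    b • ((ξ : Euc (d + 1)) -
      ⟪(ξ : Euc (d + 1)), (npole d : Euc (d + 1))⟫ • (npole d : Euc (d + 1)))

/-- `σ(r)` up to the constant `κ_{d-1}`: `∫₀^r (sin t)^{d-1} dt`. -/
def sinInt (d : ℕ) (r : ℝ) : ℝ := ∫ t in (0:ℝ)..r, (Real.sin t) ^ (d - 1)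

/-- `σ'(r)` up to the constant `κ_{d-1}`: `(sin r)^{d-1}`. -/
def sinPow (d : ℕ) (r : ℝ) : ℝ := (Real.sin r) ^ (d - 1)

section

theorem sphMeasure_eq (d : ℕ) : sphMeasure d = MeasureTheory.Measure.hausdorffMeasure (d : ℝ) := by
  unfold sphMeasure
  have hme : MeasurableEmbedding (Subtype.val : Sph d → Euc (d+1)) :=
    MeasurableEmbedding.subtype_coe isClosed_sphere.measurableSet
  ext s hs
  rw [hme.comap_apply]
  exact isometry_subtype_coe.hausdorffMeasure_image (Or.inl (by positivity)) s

instance sphMeasure_finite (d : ℕ) : IsFiniteMeasure (sphMeasure d) := by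
  have : IsFiniteMeasureOnCompacts (sphMeasure d) := by
    have : IsLocallyFiniteMeasure (sphMeasure d) := by
      refine ⟨fun x => ?_⟩
      rw [sphMeasure_eq]
      have hv : ‖((-x : Sph d) : Euc (d+1))‖ = 1 := norm_eq_of_mem_sphere (-x)
      have : Fact (Module.finrank ℝ (Euc (d+1)) = d + 1) := ⟨by simp⟩
      have hfr : Module.finrank ℝ (ℝ ∙ ((-x : Sph d) : Euc (d+1)))ᗮ = d :=
        Submodule.finrank_orthogonal_span_singleton (n := d) (ne_zero_of_mem_unit_sphere (-x))
      set V := (ℝ ∙ ((-x : Sph d) : Euc (d+1)))ᗮ with hV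
      have hcd : ContDiff ℝ 1 (stereoInvFunAux ((-x : Sph d) : Euc (d+1)) ∘ ((↑) : V → Euc (d+1))) :=
        contDiff_stereoInvFunAux.comp V.subtypeL.contDiff
      obtain ⟨K, t, ht, hK⟩ := hcd.contDiffAt.exists_lipschitzOnWith (x := (0 : V))
      have hK' : LipschitzOnWith K (stereoInvFun hv) t := fun a ha b hb => hK ha hb
      have hopen : IsOpenMap (stereographic hv).symm :=
        (isOpenEmbedding_stereographic_symm hv).isOpenMap
      have h0 : (stereographic hv).symm 0 = x := by
        rw [← stereographic_neg_apply x]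
        apply (stereographic hv).left_inv
        simp only [stereographic_source, Set.mem_compl_iff, Set.mem_singleton_iff]
        intro h
        have h2 : (x : Euc (d+1)) = -x := by simpa using congrArg Subtype.val h
        have h3 : (x : Euc (d+1)) = 0 := by
          have h4 : (2:ℝ) • (x : Euc (d+1)) = 0 := by
            rw [two_smul]; nth_rewrite 2 [h2]; exact add_neg_cancel _
          exact (smul_eq_zero.1 h4).resolve_left two_ne_zero
        exact ne_zero_of_mem_unit_sphere x h3
      have : (MeasureTheory.Measure.hausdorffMeasure (d : ℝ) : Measure V).IsAddHaarMeasure := by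
        have := MeasureTheory.isAddHaarMeasure_hausdorffMeasure (E := V)
        rwa [hfr] at this
      obtain ⟨u, hu, hu2⟩ := (MeasureTheory.Measure.hausdorffMeasure (d : ℝ) : Measure V).finiteAt_nhds 0
      refine ⟨stereoInvFun hv '' (t ∩ u), ?_, ?_⟩
      · have := hopen.image_mem_nhds (Filter.inter_mem ht hu)
        rwa [h0] at this
      · refine lt_of_le_of_lt ((hK'.mono Set.inter_subset_left).hausdorffMeasure_image_le (by positivity)) ?_
        refine ENNReal.mul_lt_top (by simp) (lt_of_le_of_lt (measure_mono Set.inter_subset_right) hu2)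
    infer_instance
  have : CompactSpace (Sph d) := isCompact_iff_compactSpace.1 (isCompact_sphere _ _)
  exact ⟨isCompact_univ.measure_lt_top⟩

instance sph_compact (d : ℕ) : CompactSpace (Sph d) := isCompact_iff_compactSpace.1 (isCompact_sphere _ _)

/-- the exponential of a linear map -/
def rotL {E : Type*} [NormedAddCommGroup E] [InnerProductSpace ℝ E] [CompleteSpace E] (A : E →L[ℝ] E) (t : ℝ) : E →L[ℝ] E := NormedSpace.exp (t • A)

theorem rotL_zero {E : Type*} [NormedAddCommGroup E] [InnerProductSpace ℝ E] [CompleteSpace E] (A : E →L[ℝ] E) (x) : rotL A 0 x = x := by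
  simp [rotL]

theorem rotL_add {E : Type*} [NormedAddCommGroup E] [InnerProductSpace ℝ E] [CompleteSpace E] (A : E →L[ℝ] E) (s t : ℝ) (x) :
    rotL A (s + t) x = rotL A s (rotL A t x) := by
  unfold rotL
  letI : NormedAlgebra ℚ (E →L[ℝ] E) := NormedAlgebra.restrictScalars ℚ ℝ (E →L[ℝ] E)
  rw [add_smul, NormedSpace.exp_add_of_commute]
  · rfl
  · exact (Commute.refl A).smul_left s |>.smul_right t

theorem rotL_comm {E : Type*} [NormedAddCommGroup E] [InnerProductSpace ℝ E] [CompleteSpace E] (A : E →L[ℝ] E) (t : ℝ) (x) :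
    rotL A t (A x) = A (rotL A t x) := by
  have : Commute (rotL A t) A := ((Commute.refl A).smul_left t).exp_left
  exact congrArg (fun L : E →L[ℝ] E => L x) this.eq

theorem hasDerivAt_rotL {E : Type*} [NormedAddCommGroup E] [InnerProductSpace ℝ E] [CompleteSpace E] (A : E →L[ℝ] E) (t : ℝ) (x) :
    HasDerivAt (fun t => rotL A t x) (A (rotL A t x)) t := by
  have := hasDerivAt_exp_smul_const' A t
  exact (this.clm_apply (hasDerivAt_const t x)).congr_deriv (by simp; rfl)

theorem continuous_rotL {E : Type*} [NormedAddCommGroup E] [InnerProductSpace ℝ E] [CompleteSpace E] (A : E →L[ℝ] E) : Continuous (rotL A) :=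
  continuous_iff_continuousAt.2 fun t => (hasDerivAt_exp_smul_const' A t).continuousAt

theorem norm_rotL {E : Type*} [NormedAddCommGroup E] [InnerProductSpace ℝ E] [CompleteSpace E] (A : E →L[ℝ] E) (hA : ∀ x, ⟪A x, x⟫ = 0) (t : ℝ) (x) :
    ‖rotL A t x‖ = ‖x‖ := by
  have h : ∀ t, HasDerivAt (fun t => ⟪rotL A t x, rotL A t x⟫) 0 t := fun t => by
    have := (hasDerivAt_rotL A t x).inner ℝ (hasDerivAt_rotL A t x)
    refine this.congr_deriv ?_
    rw [real_inner_comm, hA]; simp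
  have h2 := is_const_of_deriv_eq_zero (fun t => (h t).differentiableAt) (fun t => (h t).deriv) t 0
  simp only [rotL_zero, real_inner_self_eq_norm_sq] at h2
  exact (pow_left_inj₀ (norm_nonneg _) (norm_nonneg _) two_ne_zero).1 h2

/-- the flow on the sphere -/
def flow {d : ℕ} (A : Euc (d+1) →L[ℝ] Euc (d+1)) (hA : ∀ x, ⟪A x, x⟫ = 0) (t : ℝ) : C(Sph d, Sph d) where
  toFun x := ⟨rotL A t x, by
    rw [mem_sphere_zero_iff_norm, norm_rotL A hA, ← mem_sphere_zero_iff_norm]; exact x.2⟩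
  continuous_toFun := by fun_prop

variable {d : ℕ} (A : Euc (d+1) →L[ℝ] Euc (d+1)) (hA : ∀ x, ⟪A x, x⟫ = 0)

theorem flow_coe (t : ℝ) (x : Sph d) : (flow A hA t x : Euc (d+1)) = rotL A t x := rfl

theorem flow_zero (x : Sph d) : flow A hA 0 x = x := Subtype.ext (rotL_zero A _)

theorem flow_add (s t : ℝ) (x : Sph d) : flow A hA (s+t) x = flow A hA s (flow A hA t x) :=
  Subtype.ext (rotL_add A s t _)

theorem flow_neg_self (t : ℝ) (x : Sph d) : flow A hA (-t) (flow A hA t x) = x := by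
  rw [← flow_add]; simp [flow_zero]

theorem flow_self_neg (t : ℝ) (x : Sph d) : flow A hA t (flow A hA (-t) x) = x := by
  rw [← flow_add]; simp [flow_zero]

theorem flow_continuous : Continuous (flow A hA) := by
  apply ContinuousMap.continuous_of_continuous_uncurry
  refine Continuous.subtype_mk ?_ _
  exact ((continuous_rotL A).comp continuous_fst).clm_apply (continuous_subtype_val.comp continuous_snd)

theorem flow_mp (t : ℝ) : MeasurePreserving (flow A hA t) (sphMeasure d) (sphMeasure d) := by
  rw [sphMeasure_eq]
  let e : Sph d ≃ᵢ Sph d :=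
    { toFun := flow A hA t
      invFun := flow A hA (-t)
      left_inv := flow_neg_self A hA t
      right_inv := flow_self_neg A hA t
      isometry_toFun := by
        refine Isometry.of_dist_eq fun x y => ?_
        rw [Subtype.dist_eq, Subtype.dist_eq, flow_coe, flow_coe, dist_eq_norm, dist_eq_norm,
          ← map_sub, norm_rotL A hA] }
  exact e.measurePreserving_hausdorffMeasure d

theorem flow_integral (t : ℝ) (u : Sph d → ℝ) (v : Sph d → ℝ) :
    ∫ x, u x * v (flow A hA t x) ∂(sphMeasure d) = ∫ x, u (flow A hA (-t) x) * v x ∂(sphMeasure d) := by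
  let e : Sph d ≃ᵐ Sph d :=
    { toFun := flow A hA t
      invFun := flow A hA (-t)
      left_inv := flow_neg_self A hA t
      right_inv := flow_self_neg A hA t
      measurable_toFun := (flow A hA t).continuous.measurable
      measurable_invFun := (flow A hA (-t)).continuous.measurable }
  have := (flow_mp A hA t).integral_comp e.measurableEmbedding (fun x => u (flow A hA (-t) x) * v x)
  rw [← this]
  simp [flow_neg_self]


end

section

theorem sph_bdd {d : ℕ} {ψ : Sph d → ℝ} (hψ : Continuous ψ) : ∃ C, 0 ≤ C ∧ ∀ x, ‖ψ x‖ ≤ C := by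
  obtain ⟨C, hC⟩ := isCompact_univ.exists_bound_of_continuousOn hψ.continuousOn
  exact ⟨max C 0, le_max_right _ _, fun x => (hC x (Set.mem_univ x)).trans (le_max_left _ _)⟩

theorem sph_int_mul {d : ℕ} {ψ : Sph d → ℝ} (hψ : Continuous ψ) {u : Sph d → ℝ}
    (hu : Integrable u (sphMeasure d)) : Integrable (fun x => ψ x * u x) (sphMeasure d) := by
  obtain ⟨C, -, hC⟩ := sph_bdd hψ
  exact hu.bdd_mul hψ.aestronglyMeasurable (Eventually.of_forall hC)

theorem sph_sep {d : ℕ} {u : Sph d → ℝ} (hu : Integrable u (sphMeasure d))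
    (h : ∀ φ : Euc (d+1) → ℝ, ContDiff ℝ (⊤ : ℕ∞) φ → ∫ x, φ (x : Euc (d+1)) * u x ∂(sphMeasure d) = 0) :
    ∀ᵐ x ∂(sphMeasure d), u x = 0 := by
  have hme : MeasurableEmbedding (Subtype.val : Sph d → Euc (d+1)) :=
    MeasurableEmbedding.subtype_coe isClosed_sphere.measurableSet
  set w : Euc (d+1) → ℝ := Function.extend Subtype.val u 0 with hw
  have hwu : ∀ x : Sph d, w x = u x := fun x => Subtype.val_injective.extend_apply u 0 x
  have hcomp : w ∘ (Subtype.val : Sph d → Euc (d+1)) = u := funext hwu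
  have hInteg : Integrable w (Measure.map Subtype.val (sphMeasure d)) := by
    rw [hme.integrable_map_iff, hcomp]; exact hu
  have := ae_eq_zero_of_integral_contDiff_smul_eq_zero hInteg.locallyIntegrable (fun g hg _ => by
    rw [hme.integral_map]
    simp only [hwu, smul_eq_mul]
    exact h g hg)
  rw [hme.ae_map_iff] at this
  simpa only [hwu] using this

/-- weak derivative along a linear field -/
def WeakA {d : ℕ} (A : Euc (d+1) →L[ℝ] Euc (d+1)) (f G : Sph d → ℝ) : Prop :=
  ∀ φ : Euc (d+1) → ℝ, ContDiff ℝ (⊤ : ℕ∞) φ →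
    ∫ x, φ (x : Euc (d+1)) * G x ∂(sphMeasure d) =
      - ∫ x, (fderiv ℝ φ (x : Euc (d+1)) (A x)) * f x ∂(sphMeasure d)

variable {d : ℕ} (A : Euc (d+1) →L[ℝ] Euc (d+1)) (hA : ∀ x, ⟪A x, x⟫ = 0)

theorem cont_dir {φ : Euc (d+1) → ℝ} (hφ : ContDiff ℝ (⊤ : ℕ∞) φ) :
    Continuous (fun x : Sph d => fderiv ℝ φ (x : Euc (d+1)) (A x)) := by
  have h1 : Continuous (fderiv ℝ φ) := hφ.continuous_fderiv (by simp)
  fun_prop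

theorem hasDerivAt_pair0 {φ : Euc (d+1) → ℝ} (hφ : ContDiff ℝ (⊤ : ℕ∞) φ) {f : Sph d → ℝ}
    (hf : Integrable f (sphMeasure d)) :
    HasDerivAt (fun t => ∫ x, φ (x : Euc (d+1)) * f (flow A hA t x) ∂(sphMeasure d))
      (- ∫ x, (fderiv ℝ φ (x : Euc (d+1)) (A x)) * f x ∂(sphMeasure d)) 0 := by
  obtain ⟨C, hC0, hC⟩ := sph_bdd (cont_dir A hφ)
  have hφc : Continuous (fun x : Sph d => φ x) := hφ.continuous.comp continuous_subtype_val
  have key := hasDerivAt_integral_of_dominated_loc_of_deriv_le (μ := sphMeasure d)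
    (F := fun (t : ℝ) (x : Sph d) => φ (flow A hA (-t) x : Euc (d+1)) * f x)
    (F' := fun (t : ℝ) (x : Sph d) =>
      -(fderiv ℝ φ (flow A hA (-t) x : Euc (d+1)) (A (flow A hA (-t) x : Euc (d+1)))) * f x)
    (x₀ := (0:ℝ)) (s := Set.univ) (bound := fun x => C * ‖f x‖) Filter.univ_mem
    (Eventually.of_forall fun t =>
      (sph_int_mul (hφc.comp (flow A hA (-t)).continuous) hf).aestronglyMeasurable)
    (sph_int_mul (hφc.comp (flow A hA (-0)).continuous) hf)
    (sph_int_mul (((cont_dir A hφ).comp (flow A hA (-0)).continuous).neg) hf).aestronglyMeasurable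
    (Eventually.of_forall fun x t _ => by
      rw [norm_mul, norm_neg]
      exact mul_le_mul_of_nonneg_right (hC (flow A hA (-t) x)) (norm_nonneg _))
    (hf.norm.const_mul C)
    (Eventually.of_forall fun x t _ => by
      refine HasDerivAt.mul_const ?_ (f x)
      have h1 := (hasDerivAt_rotL A (-t) (x : Euc (d+1))).scomp t (hasDerivAt_neg t)
      have h2 := (hφ.differentiable (by simp) (rotL A (-t) (x : Euc (d+1)))).hasFDerivAt.comp_hasDerivAt t h1
      refine h2.congr_deriv ?_
      simp [flow_coe])
  have h2 := key.2
  simp only [neg_zero, flow_zero, neg_mul, integral_neg] at h2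
  refine h2.congr_of_eventuallyEq (Eventually.of_forall fun t => ?_)
  exact flow_integral A hA t _ _

theorem int_flow {f : Sph d → ℝ} (hf : Integrable f (sphMeasure d)) (t : ℝ) :
    Integrable (fun x => f (flow A hA t x)) (sphMeasure d) :=
  (flow_mp A hA t).integrable_comp_of_integrable hf

theorem weakA_flow {f G : Sph d → ℝ} (h : WeakA A f G) (t : ℝ) :
    WeakA A (fun x => f (flow A hA t x)) (fun x => G (flow A hA t x)) := by
  intro φ hφ
  rw [flow_integral A hA t (fun x => φ x) G,
    flow_integral A hA t (fun x : Sph d => fderiv ℝ φ (x : Euc (d+1)) (A x)) f]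
  have := h (fun y => φ (rotL A (-t) y)) (hφ.comp (rotL A (-t)).contDiff)
  simp only [flow_coe]
  rw [this]
  congr 2
  funext x
  congr 1
  have h1 := (hφ.differentiable (by simp) (rotL A (-t) (x : Euc (d+1)))).hasFDerivAt.comp
    (x : Euc (d+1)) (rotL A (-t)).hasFDerivAt
  have h2 : fderiv ℝ (fun y => φ (rotL A (-t) y)) (x : Euc (d+1)) = _ := h1.fderiv
  rw [h2, ContinuousLinearMap.comp_apply, rotL_comm]

theorem hasDerivAt_pair {f G : Sph d → ℝ} (hf : Integrable f (sphMeasure d)) (h : WeakA A f G)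
    {φ : Euc (d+1) → ℝ} (hφ : ContDiff ℝ (⊤ : ℕ∞) φ) (t : ℝ) :
    HasDerivAt (fun t => ∫ x, φ (x : Euc (d+1)) * f (flow A hA t x) ∂(sphMeasure d))
      (∫ x, φ (x : Euc (d+1)) * G (flow A hA t x) ∂(sphMeasure d)) t := by
  have h1 := hasDerivAt_pair0 A hA hφ (int_flow A hA hf t)
  rw [← weakA_flow A hA h t φ hφ] at h1
  simp only [← flow_add] at h1
  have h2 : HasDerivAt (fun s => ∫ x, φ (x : Euc (d+1)) * f (flow A hA (t + s) x) ∂(sphMeasure d))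
      (∫ x, φ (x : Euc (d+1)) * G (flow A hA t x) ∂(sphMeasure d)) (t - t) := by
    rw [sub_self]; exact h1
  have h3 := h2.comp_sub_const t t
  simpa using h3

/-- pairing functional -/
def pairL {ψ : Sph d → ℝ} (hψ : Continuous ψ) : Lp ℝ 1 (sphMeasure d) →L[ℝ] ℝ :=
  LinearMap.mkContinuous
    { toFun := fun u => ∫ x, ψ x * u x ∂(sphMeasure d)
      map_add' := fun u v => by
        rw [← integral_add (sph_int_mul hψ (L1.integrable_coeFn u)) (sph_int_mul hψ (L1.integrable_coeFn v))]
        refine integral_congr_ae ?_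
        filter_upwards [Lp.coeFn_add u v] with x hx
        rw [hx, Pi.add_apply]; ring
      map_smul' := fun c u => by
        rw [RingHom.id_apply, smul_eq_mul, ← integral_const_mul]
        refine integral_congr_ae ?_
        filter_upwards [Lp.coeFn_smul c u] with x hx
        rw [hx, Pi.smul_apply, smul_eq_mul]; ring }
    (sph_bdd hψ).choose (fun u => by
      obtain ⟨hC0, hC⟩ := (sph_bdd hψ).choose_spec
      simp only [LinearMap.coe_mk, AddHom.coe_mk]
      rw [L1.norm_eq_integral_norm, ← integral_const_mul]
      refine norm_integral_le_of_norm_le ((L1.integrable_coeFn u).norm.const_mul _) ?_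
      refine Eventually.of_forall fun x => ?_
      rw [norm_mul]
      exact mul_le_mul_of_nonneg_right (hC x) (norm_nonneg _))

theorem pairL_apply {ψ : Sph d → ℝ} (hψ : Continuous ψ) (u : Lp ℝ 1 (sphMeasure d)) :
    pairL hψ u = ∫ x, ψ x * u x ∂(sphMeasure d) := rfl

theorem pairL_toL1 {ψ : Sph d → ℝ} (hψ : Continuous ψ) {u : Sph d → ℝ} (hu : Integrable u (sphMeasure d)) :
    pairL hψ (hu.toL1 u) = ∫ x, ψ x * u x ∂(sphMeasure d) := by
  rw [pairL_apply]
  refine integral_congr_ae ?_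
  filter_upwards [hu.coeFn_toL1] with x hx
  rw [hx]

theorem continuous_curve {G : Sph d → ℝ} (hG : Integrable G (sphMeasure d)) :
    Continuous (fun t => (int_flow A hA hG t).toL1 _) := by
  have h := Continuous.compMeasurePreservingLp (μ := sphMeasure d) (ν := sphMeasure d) (p := 1)
    (f := fun _ : ℝ => hG.toL1 G) (g := flow A hA) continuous_const (flow_continuous A hA)
    (flow_mp A hA) (by simp)
  exact h

theorem hasDerivAt_curve {f G : Sph d → ℝ} (hf : Integrable f (sphMeasure d))
    (hG : Integrable G (sphMeasure d)) (h : WeakA A f G) :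
    HasDerivAt (fun t => (int_flow A hA hf t).toL1 _) ((int_flow A hA hG 0).toL1 _) 0 := by
  set c := (fun t => (int_flow A hA hf t).toL1 _) with hc
  set γ := (fun t => (int_flow A hA hG t).toL1 _) with hγ
  have hγc : Continuous γ := continuous_curve A hA hG
  have hI : ∀ t, HasDerivAt (fun t => ∫ s in (0:ℝ)..t, γ s) (γ t) t := fun t =>
    intervalIntegral.integral_hasDerivAt_right (hγc.intervalIntegrable _ _)
      hγc.stronglyMeasurable.stronglyMeasurableAtFilter hγc.continuousAt
  have hD : ∀ t, c t - (∫ s in (0:ℝ)..t, γ s) = c 0 := by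
    intro t
    rw [← sub_eq_zero]
    set u := c t - (∫ s in (0:ℝ)..t, γ s) - c 0 with hu
    have hae : ∀ᵐ x ∂(sphMeasure d), u x = 0 := by
      refine sph_sep (L1.integrable_coeFn u) fun φ hφ => ?_
      have hφc : Continuous (fun x : Sph d => φ x) := hφ.continuous.comp continuous_subtype_val
      change pairL hφc u = 0
      have hd : ∀ s, HasDerivAt (fun s => pairL hφc (c s - (∫ s in (0:ℝ)..s, γ s))) 0 s := by
        intro s
        have e1 := hasDerivAt_pair A hA hf h hφ s
        have e2 := (pairL hφc).hasFDerivAt.comp_hasDerivAt s (hI s)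
        have e3 := e1.sub e2
        have e4 : pairL hφc (γ s) = (∫ x, φ (x : Euc (d+1)) * G (flow A hA s x) ∂(sphMeasure d)) :=
          pairL_toL1 hφc _
        rw [e4, sub_self] at e3
        refine e3.congr_of_eventuallyEq (Eventually.of_forall fun r => ?_)
        simp only [map_sub, Pi.sub_apply, Function.comp]
        congr 1
        exact pairL_toL1 hφc _
      have := is_const_of_deriv_eq_zero (fun t => (hd t).differentiableAt) (fun t => (hd t).deriv) t 0
      rw [hu, map_sub, this]
      simp
    have hae' : (u : Sph d → ℝ) =ᵐ[sphMeasure d] 0 := hae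
    exact Lp.ext (hae'.trans (Lp.coeFn_zero ℝ 1 (sphMeasure d)).symm)
  refine ((hI 0).const_add (c 0)).congr_of_eventuallyEq (Eventually.of_forall fun t => ?_)
  simp only
  rw [← hD t]; abel


end

section

variable {d : ℕ} (A : Euc (d+1) →L[ℝ] Euc (d+1))

theorem slope_L1 (hA : ∀ x, ⟪A x, x⟫ = 0) {f G : Sph d → ℝ} (hf : Integrable f (sphMeasure d))
    (hG : Integrable G (sphMeasure d)) (h : WeakA A f G) :
    Tendsto (fun t : ℝ => t⁻¹ * ∫ x, ‖f (flow A hA t x) - f x - t * G x‖ ∂(sphMeasure d))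
      (𝓝[>] 0) (𝓝 0) := by
  have h1 := (hasDerivAt_iff_tendsto.1 (hasDerivAt_curve A hA hf hG h)).mono_left
    (nhdsWithin_le_nhds (s := Set.Ioi 0))
  refine h1.congr' ?_
  filter_upwards [self_mem_nhdsWithin] with t ht
  have ht : 0 < t := ht
  rw [sub_zero, Real.norm_of_nonneg ht.le]
  congr 1
  rw [L1.norm_eq_integral_norm]
  refine integral_congr_ae ?_
  filter_upwards [Lp.coeFn_sub ((int_flow A hA hf t).toL1 _ - (int_flow A hA hf 0).toL1 _)
      (t • (int_flow A hA hG 0).toL1 _),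
    Lp.coeFn_sub ((int_flow A hA hf t).toL1 _) ((int_flow A hA hf 0).toL1 _),
    Lp.coeFn_smul t ((int_flow A hA hG 0).toL1 _),
    (int_flow A hA hf t).coeFn_toL1, (int_flow A hA hf 0).coeFn_toL1, (int_flow A hA hG 0).coeFn_toL1]
    with x h1 h2 h3 h4 h5 h6
  rw [h1, Pi.sub_apply, h2, Pi.sub_apply, h3, Pi.smul_apply, h4, h5, h6, flow_zero, smul_eq_mul]

/-- one sided derivative of `t ↦ |a + t b|` -/
def absD (a b : ℝ) : ℝ := Real.sign a * b + if a = 0 then |b| else 0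

theorem absD_tendsto (a b : ℝ) :
    Tendsto (fun t : ℝ => t⁻¹ * (|a + t * b| - |a|)) (𝓝[>] 0) (𝓝 (absD a b)) := by
  unfold absD
  by_cases ha : a = 0
  · subst ha
    simp only [Real.sign_zero, zero_mul, if_true, zero_add, abs_zero, sub_zero]
    refine tendsto_const_nhds.congr' ?_
    filter_upwards [self_mem_nhdsWithin] with t ht
    have ht : 0 < t := ht
    rw [abs_mul, abs_of_pos ht]; field_simp
  · rw [if_neg ha, add_zero]
    have hc : Tendsto (fun t : ℝ => a + t * b) (𝓝[>] 0) (𝓝 a) := by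
      have : Continuous (fun t : ℝ => a + t * b) := by fun_prop
      simpa using (this.tendsto 0).mono_left (nhdsWithin_le_nhds (s := Set.Ioi 0))
    refine tendsto_const_nhds.congr' ?_
    rcases lt_or_gt_of_ne ha with ha | ha
    · filter_upwards [self_mem_nhdsWithin, hc.eventually (gt_mem_nhds ha)] with t ht h2
      have ht : 0 < t := ht
      rw [abs_of_neg ha, abs_of_neg h2, Real.sign_of_neg ha]; field_simp; ring
    · filter_upwards [self_mem_nhdsWithin, hc.eventually (lt_mem_nhds ha)] with t ht h2
      have ht : 0 < t := ht
      rw [abs_of_pos ha, abs_of_pos h2, Real.sign_of_pos ha]; field_simp; ring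

theorem measurable_sign' : Measurable Real.sign := by
  unfold Real.sign
  exact Measurable.ite measurableSet_Iio measurable_const
    (Measurable.ite measurableSet_Ioi measurable_const measurable_const)

theorem one_sided (hA : ∀ x, ⟪A x, x⟫ = 0) {f G : Sph d → ℝ} (hf : Integrable f (sphMeasure d))
    (hG : Integrable G (sphMeasure d)) (h : WeakA A f G)
    {φ : Euc (d+1) → ℝ} (hφ : ContDiff ℝ (⊤ : ℕ∞) φ) :
    (- ∫ x, (fderiv ℝ φ (x : Euc (d+1)) (A x)) * |f x| ∂(sphMeasure d)) =
      ∫ x, φ (x : Euc (d+1)) * absD (f x) (G x) ∂(sphMeasure d) := by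
  have hφc : Continuous (fun x : Sph d => φ x) := hφ.continuous.comp continuous_subtype_val
  obtain ⟨C, hC0, hC⟩ := sph_bdd hφc
  have hmono : (𝓝[>] (0:ℝ)) ≤ 𝓝[≠] 0 := nhdsWithin_mono _ (fun x hx => ne_of_gt hx)
  have ha := (hasDerivAt_iff_tendsto_slope_zero.1 (hasDerivAt_pair0 A hA hφ hf.abs)).mono_left hmono
  have hb : Tendsto (fun t : ℝ => ∫ x, φ (x : Euc (d+1)) * (t⁻¹ * (|f x + t * G x| - |f x|)) ∂(sphMeasure d))
      (𝓝[>] 0) (𝓝 (∫ x, φ (x : Euc (d+1)) * absD (f x) (G x) ∂(sphMeasure d))) := by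
    refine tendsto_integral_filter_of_dominated_convergence (fun x => C * ‖G x‖) ?_ ?_
      (hG.norm.const_mul C) ?_
    · refine Eventually.of_forall fun t => ?_
      exact (sph_int_mul hφc (((hf.add (hG.const_mul t)).abs.sub hf.abs).const_mul _)).aestronglyMeasurable
    · filter_upwards [self_mem_nhdsWithin] with t ht
      have ht : 0 < t := ht
      refine Eventually.of_forall fun x => ?_
      rw [norm_mul]
      refine mul_le_mul (hC x) ?_ (norm_nonneg _) hC0
      rw [norm_mul, norm_inv, Real.norm_of_nonneg ht.le, inv_mul_le_iff₀ ht]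
      have := abs_abs_sub_abs_le_abs_sub (f x + t * G x) (f x)
      rw [add_sub_cancel_left, abs_mul, abs_of_pos ht] at this
      exact this
    · exact Eventually.of_forall fun x => (absD_tendsto (f x) (G x)).const_mul _
  refine tendsto_nhds_unique ha ?_
  have hs := (slope_L1 A hA hf hG h).const_mul C
  rw [mul_zero] at hs
  have hdiff := squeeze_zero_norm' (f := fun t : ℝ =>
    t⁻¹ • ((∫ x, φ (x : Euc (d+1)) * |f (flow A hA (0 + t) x)| ∂(sphMeasure d)) -
      ∫ x, φ (x : Euc (d+1)) * |f (flow A hA 0 x)| ∂(sphMeasure d)) -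
    ∫ x, φ (x : Euc (d+1)) * (t⁻¹ * (|f x + t * G x| - |f x|)) ∂(sphMeasure d)) ?_ hs
  · have := hdiff.add hb
    rw [zero_add] at this
    exact this.congr fun t => by ring
  · filter_upwards [self_mem_nhdsWithin] with t ht
    have ht : 0 < t := ht
    have i1 := sph_int_mul hφc (int_flow A hA hf t).abs
    have i2 := sph_int_mul hφc hf.abs
    have i3 := sph_int_mul hφc (((hf.add (hG.const_mul t)).abs.sub hf.abs).const_mul t⁻¹)
    simp only [zero_add, flow_zero]
    rw [smul_eq_mul, ← integral_sub i1 i2, ← integral_const_mul]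
    have e := integral_sub ((i1.sub i2).const_mul t⁻¹) i3
    simp only [Pi.sub_apply, Pi.add_apply] at e
    rw [← e, ← integral_const_mul, ← integral_const_mul]
    refine norm_integral_le_of_norm_le
      (((((int_flow A hA hf t).sub hf).sub (hG.const_mul t)).norm.const_mul t⁻¹).const_mul C) ?_
    refine Eventually.of_forall fun x => ?_
    have e2 : t⁻¹ * (φ (x : Euc (d+1)) * |f (flow A hA t x)| - φ (x : Euc (d+1)) * |f x|) -
        φ (x : Euc (d+1)) * (t⁻¹ * (|f x + t * G x| - |f x|)) =
        φ (x : Euc (d+1)) * (t⁻¹ * (|f (flow A hA t x)| - |f x + t * G x|)) := by ring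
    rw [e2, norm_mul]
    refine mul_le_mul (hC x) ?_ (norm_nonneg _) hC0
    rw [norm_mul, norm_inv, Real.norm_of_nonneg ht.le]
    refine mul_le_mul_of_nonneg_left ?_ (by positivity)
    have := abs_abs_sub_abs_le_abs_sub (f (flow A hA t x)) (f x + t * G x)
    rw [← sub_sub] at this
    exact this

theorem weakA_neg {f G : Sph d → ℝ} (h : WeakA A f G) : WeakA (-A) f (fun x => - G x) := by
  intro φ hφ
  have := h φ hφ
  simp [integral_neg, this]

theorem absD_int {f G : Sph d → ℝ} (hf : Integrable f (sphMeasure d))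
    (hG : Integrable G (sphMeasure d)) : Integrable (fun x => absD (f x) (G x)) (sphMeasure d) := by
  refine Integrable.mono' (hG.norm.const_mul 1) ?_ ?_
  · have hs : AEMeasurable (fun x => Real.sign (f x)) (sphMeasure d) := measurable_sign'.comp_aemeasurable hf.1.aemeasurable
    have hz : AEMeasurable (fun x => if f x = 0 then (1:ℝ) else 0) (sphMeasure d) :=
      (Measurable.ite (measurableSet_singleton (0:ℝ)) measurable_const measurable_const :
        Measurable (fun y : ℝ => if y = 0 then (1:ℝ) else 0)).comp_aemeasurable hf.1.aemeasurable
    have := (hs.mul hG.1.aemeasurable).add (hz.mul hG.1.aemeasurable.abs)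
    refine this.aestronglyMeasurable.congr (Eventually.of_forall fun x => ?_)
    simp [absD]
  · refine Eventually.of_forall fun x => ?_
    unfold absD
    rcases lt_trichotomy (f x) 0 with h | h | h
    · simp [Real.sign_of_neg h, h.ne]
    · simp [h]
    · simp [Real.sign_of_pos h, h.ne']

theorem chain_abs (hA : ∀ x, ⟪A x, x⟫ = 0) {f G : Sph d → ℝ} (hf : Integrable f (sphMeasure d))
    (hG : Integrable G (sphMeasure d)) (h : WeakA A f G) :
    (∀ᵐ x ∂(sphMeasure d), f x = 0 → G x = 0) ∧
      WeakA A (fun x => |f x|) (fun x => Real.sign (f x) * G x) := by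
  have hA' : ∀ x, ⟪(-A) x, x⟫ = 0 := fun x => by simp [inner_neg_left, hA]
  have hae : ∀ᵐ x ∂(sphMeasure d), f x = 0 → G x = 0 := by
    have h1 := one_sided A hA hf hG h (φ := fun _ => 1) contDiff_const
    have h2 := one_sided (-A) hA' hf hG.neg (weakA_neg A h) (φ := fun _ => 1) contDiff_const
    have h0 : ∀ x : Euc (d+1), fderiv ℝ (fun _ : Euc (d+1) => (1:ℝ)) x = 0 := fun x => by simp
    simp only [h0, zero_apply, zero_mul, integral_zero, neg_zero, one_mul] at h1 h2
    have h3 : ∫ x, (absD (f x) (G x) + absD (f x) ((-G) x)) ∂(sphMeasure d) = 0 := by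
      rw [integral_add (absD_int hf hG) (absD_int hf hG.neg), ← h1]
      rw [zero_add]; exact h2.symm
    have hnn : ∀ x, absD (f x) (G x) + absD (f x) ((-G) x) = if f x = 0 then 2 * |G x| else 0 := by
      intro x
      unfold absD
      by_cases hx : f x = 0 <;> simp [hx]
      ring
    have hInteg : Integrable (fun x => if f x = 0 then 2 * |G x| else 0) (sphMeasure d) := by
      refine ((absD_int hf hG).add (absD_int hf hG.neg)).congr (Eventually.of_forall fun x => ?_)
      exact hnn x
    simp only [hnn] at h3
    rw [integral_eq_zero_iff_of_nonneg (fun x => by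
      simp only [Pi.zero_apply]; split_ifs <;> positivity) hInteg] at h3
    filter_upwards [h3] with x hx h0
    simp only [if_pos h0] at hx
    simpa using hx
  refine ⟨hae, fun φ hφ => ?_⟩
  rw [one_sided A hA hf hG h hφ]
  refine integral_congr_ae ?_
  filter_upwards [hae] with x hx
  unfold absD
  by_cases h0 : f x = 0
  · simp [h0, hx h0]
  · simp [h0]


end

section

/-- basis vector -/
def eb {n : ℕ} (i : Fin n) : Euc n := EuclideanSpace.single i 1

/-- infinitesimal rotation in the `i,j` plane -/
def Aij {n : ℕ} (i j : Fin n) : Euc n →L[ℝ] Euc n :=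
  (EuclideanSpace.proj j : Euc n →L[ℝ] ℝ).smulRight (eb i) -
    (EuclideanSpace.proj i : Euc n →L[ℝ] ℝ).smulRight (eb j)

theorem Aij_apply {n : ℕ} (i j : Fin n) (x : Euc n) : Aij i j x = x j • eb i - x i • eb j := by
  simp [Aij]

theorem inner_eb {n : ℕ} (i : Fin n) (x : Euc n) : ⟪x, eb i⟫ = x i := by
  simp [eb, EuclideanSpace.inner_single_right]

theorem Aij_inner {n : ℕ} (i j : Fin n) (x y : Euc n) : ⟪y, Aij i j x⟫ = x j * y i - x i * y j := by
  rw [Aij_apply, inner_sub_right, inner_smul_right, inner_smul_right, inner_eb, inner_eb]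

theorem Aij_skew {n : ℕ} (i j : Fin n) (x : Euc n) : ⟪Aij i j x, x⟫ = 0 := by
  rw [real_inner_comm, Aij_inner]; ring

theorem sum_eb {n : ℕ} (x : Euc n) : ∑ j, x j • eb j = x := by
  ext k
  simp [eb, Finset.sum_apply, Pi.single_apply]

theorem sum_sq {d : ℕ} (x : Sph d) : ∑ j, (x : Euc (d+1)) j * (x : Euc (d+1)) j = 1 := by
  have h : ‖(x : Euc (d+1))‖ = 1 := norm_eq_of_mem_sphere x
  have h2 := EuclideanSpace.norm_sq_eq (x : Euc (d+1))
  rw [h] at h2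
  simp only [Real.norm_eq_abs, sq_abs] at h2
  simp only [← sq]; linarith

theorem inner_sumE {n : ℕ} (x y : Euc n) : ⟪x, y⟫ = ∑ j, y j * x j := by
  simp [PiLp.inner_apply]

theorem eb_apply {n : ℕ} (i j : Fin n) : (eb i : Euc n) j = if j = i then 1 else 0 := by
  simp [eb]

theorem pointwise_id {d : ℕ} (D : Euc (d+1) →L[ℝ] ℝ) (p : ℝ) (x : Sph d) (i : Fin (d+1)) :
    ∑ j, (p * (Aij i j (x : Euc (d+1))) j + (x : Euc (d+1)) j * D (Aij i j (x : Euc (d+1)))) =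
      (D (eb i) - D (x : Euc (d+1)) * (x : Euc (d+1)) i) - d * (p * (x : Euc (d+1)) i) := by
  have h1 : D (x : Euc (d+1)) = ∑ j, (x : Euc (d+1)) j * D (eb j) := by
    conv_lhs => rw [← sum_eb (x : Euc (d+1))]
    simp
  have h2 : ∀ j, (Aij i j (x : Euc (d+1))) j = (if j = i then (x : Euc (d+1)) j else 0) - (x : Euc (d+1)) i := by
    intro j
    rw [Aij_apply]
    simp [eb_apply]
  have h3 : ∀ j, (x : Euc (d+1)) j * D (Aij i j (x : Euc (d+1))) =
      ((x : Euc (d+1)) j * (x : Euc (d+1)) j) * D (eb i) - (x : Euc (d+1)) i * ((x : Euc (d+1)) j * D (eb j)) := by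
    intro j
    rw [Aij_apply]; simp; ring
  rw [Finset.sum_add_distrib, ← Finset.mul_sum]
  simp only [h2, h3]
  rw [Finset.sum_sub_distrib, Finset.sum_sub_distrib, ← Finset.sum_mul, sum_sq, ← Finset.mul_sum, ← h1]
  simp
  ring

theorem cont_coe {d : ℕ} {φ : Euc (d+1) → ℝ} (hφ : ContDiff ℝ (⊤ : ℕ∞) φ) :
    Continuous (fun x : Sph d => φ x) := hφ.continuous.comp continuous_subtype_val

theorem cont_coord {d : ℕ} (i : Fin (d+1)) : Continuous (fun x : Sph d => (x : Euc (d+1)) i) := by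
  fun_prop

theorem cont_fd {d : ℕ} {φ : Euc (d+1) → ℝ} (hφ : ContDiff ℝ (⊤ : ℕ∞) φ) (i : Fin (d+1)) :
    Continuous (fun x : Sph d => fderiv ℝ φ (x : Euc (d+1)) (eb i) -
      fderiv ℝ φ (x : Euc (d+1)) x * (x : Euc (d+1)) i) := by
  have h1 : Continuous (fderiv ℝ φ) := hφ.continuous_fderiv (by simp)
  have h2 := cont_coord (d := d) i
  fun_prop

theorem int_coord {d : ℕ} {g : Sph d → Euc (d+1)} (hg : Integrable g (sphMeasure d)) (i : Fin (d+1)) :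
    Integrable (fun x => g x i) (sphMeasure d) :=
  (EuclideanSpace.proj i : Euc (d+1) →L[ℝ] ℝ).integrable_comp hg

theorem coord_integral {d : ℕ} {g : Sph d → Euc (d+1)} (hg : Integrable g (sphMeasure d)) (i : Fin (d+1)) :
    (∫ x, g x ∂(sphMeasure d)) i = ∫ x, g x i ∂(sphMeasure d) :=
  ((EuclideanSpace.proj i : Euc (d+1) →L[ℝ] ℝ).integral_comp_comm hg).symm

theorem tangProj_coord {d : ℕ} {φ : Euc (d+1) → ℝ} (hφ : ContDiff ℝ (⊤ : ℕ∞) φ) (x : Sph d) (i : Fin (d+1)) :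
    (tangProj x (gradient φ (x : Euc (d+1)))) i = fderiv ℝ φ (x : Euc (d+1)) (eb i) -
      fderiv ℝ φ (x : Euc (d+1)) x * (x : Euc (d+1)) i := by
  have h : ∀ v, ⟪gradient φ (x : Euc (d+1)), v⟫ = fderiv ℝ φ (x : Euc (d+1)) v := fun v => by
    simp [gradient]
  unfold tangProj
  rw [← h, ← h, inner_eb]
  simp

theorem int_smul_cont {d : ℕ} {v : Sph d → Euc (d+1)} (hv : Continuous v) {u : Sph d → ℝ}
    (hu : Integrable u (sphMeasure d)) : Integrable (fun x => u x • v x) (sphMeasure d) := by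
  obtain ⟨C, hC⟩ := isCompact_univ.exists_bound_of_continuousOn hv.continuousOn
  exact hu.smul_bdd C hv.aestronglyMeasurable (Eventually.of_forall fun x => hC x (Set.mem_univ x))

theorem weak_iff {d : ℕ} {f : Sph d → ℝ} {g : Sph d → Euc (d+1)} (hf : Integrable f (sphMeasure d))
    (hg : Integrable g (sphMeasure d)) {φ : Euc (d+1) → ℝ} (hφ : ContDiff ℝ (⊤ : ℕ∞) φ) :
    (∫ η, φ (η : Euc (d + 1)) • g η ∂(sphMeasure d)
      = - ∫ η, f η • tangProj η (gradient φ (η : Euc (d + 1))) ∂(sphMeasure d)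
        + (d : ℝ) • ∫ η, (f η * φ (η : Euc (d + 1))) • (η : Euc (d + 1)) ∂(sphMeasure d)) ↔
    ∀ i, ∫ x, φ (x : Euc (d+1)) * g x i ∂(sphMeasure d) =
      - ∫ x, (fderiv ℝ φ (x : Euc (d+1)) (eb i) -
        fderiv ℝ φ (x : Euc (d+1)) x * (x : Euc (d+1)) i) * f x ∂(sphMeasure d) +
      d * ∫ x, (φ (x : Euc (d+1)) * (x : Euc (d+1)) i) * f x ∂(sphMeasure d) := by
  have hφc := cont_coe (d := d) hφ
  obtain ⟨C, -, hC⟩ := sph_bdd hφc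
  have i1 : Integrable (fun η : Sph d => φ (η : Euc (d + 1)) • g η) (sphMeasure d) :=
    hg.bdd_smul C hφc.aestronglyMeasurable (Eventually.of_forall hC)
  have ht : Continuous (fun η : Sph d => tangProj η (gradient φ (η : Euc (d + 1)))) := by
    have h1 : Continuous (gradient φ) := by
      unfold gradient
      exact (LinearIsometryEquiv.continuous _).comp (hφ.continuous_fderiv (by simp))
    unfold tangProj
    fun_prop
  have i2 := int_smul_cont ht hf
  have i3 : Integrable (fun η : Sph d => (f η * φ (η : Euc (d + 1))) • (η : Euc (d + 1))) (sphMeasure d) := by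
    refine int_smul_cont continuous_subtype_val ?_
    exact (sph_int_mul hφc hf).congr (Eventually.of_forall fun x => mul_comm _ _)
  have key : ∀ i, ((∫ η, φ (η : Euc (d + 1)) • g η ∂(sphMeasure d)) i = ∫ x, φ (x : Euc (d+1)) * g x i ∂(sphMeasure d)) ∧
    ((- ∫ η, f η • tangProj η (gradient φ (η : Euc (d + 1))) ∂(sphMeasure d)
        + (d : ℝ) • ∫ η, (f η * φ (η : Euc (d + 1))) • (η : Euc (d + 1)) ∂(sphMeasure d)) i =
     - ∫ x, (fderiv ℝ φ (x : Euc (d+1)) (eb i) -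
        fderiv ℝ φ (x : Euc (d+1)) x * (x : Euc (d+1)) i) * f x ∂(sphMeasure d) +
      d * ∫ x, (φ (x : Euc (d+1)) * (x : Euc (d+1)) i) * f x ∂(sphMeasure d)) := by
    intro i
    constructor
    · rw [coord_integral i1]; simp
    · rw [PiLp.add_apply, PiLp.neg_apply, PiLp.smul_apply, coord_integral i2, coord_integral i3]
      simp only [PiLp.smul_apply, tangProj_coord hφ, smul_eq_mul]
      congr 3
      · funext x; ring
      · congr 1; funext x; ring
  constructor
  · intro h i
    rw [← (key i).1, ← (key i).2, h]
  · intro h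
    ext i
    rw [(key i).1, (key i).2, h]

theorem contDiff_mul_coord {n : ℕ} {φ : Euc n → ℝ} (hφ : ContDiff ℝ (⊤ : ℕ∞) φ) (i : Fin n) :
    ContDiff ℝ (⊤ : ℕ∞) (fun x : Euc n => φ x * x i) :=
  hφ.mul (EuclideanSpace.proj i : Euc n →L[ℝ] ℝ).contDiff

theorem fderiv_mul_coord {n : ℕ} {φ : Euc n → ℝ} (hφ : ContDiff ℝ (⊤ : ℕ∞) φ) (i : Fin n) (x v : Euc n) :
    fderiv ℝ (fun x : Euc n => φ x * x i) x v = φ x * v i + x i * fderiv ℝ φ x v := by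
  have h := (hφ.differentiable (by simp) x).hasFDerivAt.mul
    (EuclideanSpace.proj i : Euc n →L[ℝ] ℝ).hasFDerivAt (x := x)
  have h2 : fderiv ℝ (fun x : Euc n => φ x * x i) x = _ := h.fderiv
  rw [h2]; simp

theorem weak_fwd {d : ℕ} {f : Sph d → ℝ} {g : Sph d → Euc (d+1)} (h : MemW11 f g) (i j : Fin (d+1)) :
    WeakA (Aij i j) f (fun x => (x : Euc (d+1)) j * g x i - (x : Euc (d+1)) i * g x j) := by
  obtain ⟨hf, hg, -, hw⟩ := h
  intro φ hφ
  have e1 := (weak_iff hf hg (contDiff_mul_coord hφ j)).1 (hw _ (contDiff_mul_coord hφ j)) i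
  have e2 := (weak_iff hf hg (contDiff_mul_coord hφ i)).1 (hw _ (contDiff_mul_coord hφ i)) j
  have i1 := sph_int_mul (cont_coe (d := d) (contDiff_mul_coord hφ j)) (int_coord hg i)
  have i2 := sph_int_mul (cont_coe (d := d) (contDiff_mul_coord hφ i)) (int_coord hg j)
  have i3 := sph_int_mul (cont_fd (d := d) (contDiff_mul_coord hφ j) i) hf
  have i4 := sph_int_mul (cont_fd (d := d) (contDiff_mul_coord hφ i) j) hf
  have s1 := integral_sub i1 i2
  have s2 := integral_sub i3 i4
  have s3 : ∫ x : Sph d, (φ (x : Euc (d+1)) * (x : Euc (d+1)) j * (x : Euc (d+1)) i) * f x ∂(sphMeasure d) =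
      ∫ x : Sph d, (φ (x : Euc (d+1)) * (x : Euc (d+1)) i * (x : Euc (d+1)) j) * f x ∂(sphMeasure d) := by
    congr 1; funext x; ring
  have l1 : ∫ x : Sph d, φ (x : Euc (d+1)) * ((x : Euc (d+1)) j * g x i - (x : Euc (d+1)) i * g x j) ∂(sphMeasure d)
      = ∫ x : Sph d, (φ (x : Euc (d+1)) * (x : Euc (d+1)) j * g x i - φ (x : Euc (d+1)) * (x : Euc (d+1)) i * g x j) ∂(sphMeasure d) := by
    congr 1; funext x; ring
  rw [l1, s1, e1, e2, s3]
  rw [show ∀ a b c : ℝ, -a + c - (-b + c) = -(a - b) by intros; ring, ← s2]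
  congr 2
  funext x
  simp only [fderiv_mul_coord hφ, Aij_apply, map_sub, map_smul, smul_eq_mul, eb_apply]
  have : (if j = i then (1:ℝ) else 0) = if i = j then 1 else 0 := by simp only [eq_comm]
  rw [this]
  ring

theorem weak_bwd {d : ℕ} {f : Sph d → ℝ} {g : Sph d → Euc (d+1)} (hf : Integrable f (sphMeasure d))
    (hg : Integrable g (sphMeasure d)) (ht : ∀ᵐ η ∂(sphMeasure d), ⟪g η, (η : Euc (d + 1))⟫ = 0)
    (h : ∀ i j : Fin (d+1),
      WeakA (Aij i j) f (fun x => (x : Euc (d+1)) j * g x i - (x : Euc (d+1)) i * g x j)) :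
    MemW11 f g := by
  refine ⟨hf, hg, ht, fun φ hφ => (weak_iff hf hg hφ).2 fun i => ?_⟩
  have hj := fun j => h i j _ (contDiff_mul_coord hφ j)
  have ic : ∀ j, Integrable (fun x : Sph d => (x : Euc (d+1)) j * g x i - (x : Euc (d+1)) i * g x j) (sphMeasure d) :=
    fun j => (sph_int_mul (cont_coord j) (int_coord hg i)).sub (sph_int_mul (cont_coord i) (int_coord hg j))
  have s1 := integral_finsetSum Finset.univ
    (fun j _ => sph_int_mul (cont_coe (d := d) (contDiff_mul_coord hφ j)) (ic j))
  have s2 := integral_finsetSum Finset.univ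
    (fun j _ => sph_int_mul (cont_dir (d := d) (Aij i j) (contDiff_mul_coord hφ j)) hf)
  have l1 : ∫ x, φ (x : Euc (d+1)) * g x i ∂(sphMeasure d) =
      ∫ x : Sph d, ∑ j, φ (x : Euc (d+1)) * (x : Euc (d+1)) j * ((x : Euc (d+1)) j * g x i - (x : Euc (d+1)) i * g x j) ∂(sphMeasure d) := by
    refine integral_congr_ae ?_
    filter_upwards [ht] with x hx
    rw [inner_sumE] at hx
    have : ∀ j, φ (x : Euc (d+1)) * (x : Euc (d+1)) j * ((x : Euc (d+1)) j * g x i - (x : Euc (d+1)) i * g x j) =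
        (x : Euc (d+1)) j * (x : Euc (d+1)) j * (φ (x : Euc (d+1)) * g x i) -
          φ (x : Euc (d+1)) * (x : Euc (d+1)) i * ((x : Euc (d+1)) j * g x j) := fun j => by ring
    simp only [this]
    rw [Finset.sum_sub_distrib, ← Finset.sum_mul, ← Finset.mul_sum, sum_sq, hx]
    ring
  rw [l1, s1, Finset.sum_congr rfl (fun j _ => hj j), Finset.sum_neg_distrib, ← s2]
  have i3 := sph_int_mul (cont_fd (d := d) hφ i) hf
  have i4 := (sph_int_mul (cont_coe (d := d) (contDiff_mul_coord hφ i)) hf).const_mul (d : ℝ)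
  have s3 := integral_sub i3 i4
  rw [integral_const_mul] at s3
  rw [show ∀ a b : ℝ, -a + b = -(a - b) by intros; ring, ← s3]
  congr 2
  funext x
  rw [← Finset.sum_mul]
  simp only [fderiv_mul_coord hφ]
  rw [pointwise_id]
  ring

theorem memW11_abs {d : ℕ} {f : Sph d → ℝ} {g : Sph d → Euc (d+1)} (h : MemW11 f g) :
    (∀ᵐ x ∂(sphMeasure d), f x = 0 → g x = 0) ∧
      MemW11 (fun x => |f x|) (fun x => Real.sign (f x) • g x) := by
  have hf := h.1
  have hg := h.2.1
  have ht := h.2.2.1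
  have ic : ∀ i j, Integrable (fun x : Sph d => (x : Euc (d+1)) j * g x i - (x : Euc (d+1)) i * g x j) (sphMeasure d) :=
    fun i j => (sph_int_mul (cont_coord j) (int_coord hg i)).sub (sph_int_mul (cont_coord i) (int_coord hg j))
  have hc := fun i j => chain_abs (Aij i j) (Aij_skew i j) hf (ic i j) (weak_fwd h i j)
  constructor
  · have h1 : ∀ᵐ x ∂(sphMeasure d), ∀ i j, f x = 0 → (x : Euc (d+1)) j * g x i - (x : Euc (d+1)) i * g x j = 0 :=
      ae_all_iff.2 fun i => ae_all_iff.2 fun j => (hc i j).1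
    filter_upwards [h1, ht] with x hx hx2 h0
    ext i
    rw [inner_sumE] at hx2
    have e : ∑ j, (x : Euc (d+1)) j * ((x : Euc (d+1)) j * g x i - (x : Euc (d+1)) i * g x j) = 0 :=
      Finset.sum_eq_zero fun j _ => by rw [hx i j h0, mul_zero]
    have : ∀ j, (x : Euc (d+1)) j * ((x : Euc (d+1)) j * g x i - (x : Euc (d+1)) i * g x j) =
        (x : Euc (d+1)) j * (x : Euc (d+1)) j * g x i -
          (x : Euc (d+1)) i * ((x : Euc (d+1)) j * g x j) := fun j => by ring
    simp only [this] at e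
    rw [Finset.sum_sub_distrib, ← Finset.sum_mul, ← Finset.mul_sum, sum_sq, hx2] at e
    simpa using e
  · refine weak_bwd hf.abs ?_ ?_ ?_
    · refine hg.bdd_smul 1 (measurable_sign'.comp_aemeasurable hf.1.aemeasurable).aestronglyMeasurable
        (Eventually.of_forall fun x => ?_)
      rcases Real.sign_apply_eq (f x) with h | h | h <;> simp [h]
    · filter_upwards [ht] with x hx
      rw [inner_smul_left, hx, mul_zero]
    · intro i j
      have := (hc i j).2
      refine (congrArg (WeakA (Aij i j) (fun x => |f x|)) (funext fun x => ?_)).mp this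
      simp only [PiLp.smul_apply, smul_eq_mul]; ring

theorem abs_conv_main (d : ℕ)
    (f : Sph d → ℝ) (g : Sph d → Euc (d + 1))
    (fj : ℕ → Sph d → ℝ) (gj : ℕ → Sph d → Euc (d + 1))
    (hf : MemW11 f g) (hfj : ∀ j, MemW11 (fj j) (gj j))
    (hconv : W11Tendsto fj gj f g) :
    W11Tendsto (fun j ξ => |fj j ξ|) (fun j x => Real.sign (fj j x) • gj j x)
      (fun ξ => |f ξ|) (fun x => Real.sign (f x) • g x) := by
  have n1 : ∀ j, 0 ≤ ∫ ξ, |fj j ξ - f ξ| ∂(sphMeasure d) := fun j => integral_nonneg fun _ => abs_nonneg _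
  have n2 : ∀ j, 0 ≤ ∫ ξ, ‖gj j ξ - g ξ‖ ∂(sphMeasure d) := fun j => integral_nonneg fun _ => norm_nonneg _
  have c1 : Tendsto (fun j => ∫ ξ, |fj j ξ - f ξ| ∂(sphMeasure d)) atTop (𝓝 0) :=
    squeeze_zero n1 (fun j => le_add_of_nonneg_right (n2 j)) hconv
  have c2 : Tendsto (fun j => ∫ ξ, ‖gj j ξ - g ξ‖ ∂(sphMeasure d)) atTop (𝓝 0) :=
    squeeze_zero n2 (fun j => le_add_of_nonneg_left (n1 j)) hconv
  have sg : ∀ a : ℝ, |Real.sign a| ≤ 1 := fun a => by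
    rcases Real.sign_apply_eq a with h | h | h <;> simp [h]
  have ms : ∀ {u : Sph d → ℝ}, Integrable u (sphMeasure d) →
      AEStronglyMeasurable (fun x => Real.sign (u x)) (sphMeasure d) := fun hu =>
    (measurable_sign'.comp_aemeasurable hu.1.aemeasurable).aestronglyMeasurable
  have bnd : ∀ j x, ‖|Real.sign (fj j x) - Real.sign (f x)| * ‖g x‖‖ ≤ 2 * ‖g x‖ := fun j x => by
    rw [norm_mul, norm_norm, Real.norm_eq_abs, abs_abs]
    refine mul_le_mul_of_nonneg_right ?_ (norm_nonneg _)
    have := abs_sub (Real.sign (fj j x)) (Real.sign (f x))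
    linarith [sg (fj j x), sg (f x)]
  have mm : ∀ j, AEStronglyMeasurable (fun x => |Real.sign (fj j x) - Real.sign (f x)| * ‖g x‖) (sphMeasure d) :=
    fun j => (((ms (hfj j).1).sub (ms hf.1)).norm).mul hf.2.1.1.norm
  have ii : ∀ j, Integrable (fun x => |Real.sign (fj j x) - Real.sign (f x)| * ‖g x‖) (sphMeasure d) :=
    fun j => (hf.2.1.norm.const_mul 2).mono' (mm j) (Eventually.of_forall (bnd j))
  have c3 : Tendsto (fun j => ∫ x, |Real.sign (fj j x) - Real.sign (f x)| * ‖g x‖ ∂(sphMeasure d)) atTop (𝓝 0) := by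
    refine tendsto_of_subseq_tendsto fun ns hns => ?_
    have hm : TendstoInMeasure (sphMeasure d) (fun n => fj (ns n)) atTop f := by
      refine tendstoInMeasure_of_tendsto_eLpNorm (p := 1) one_ne_zero
        (fun n => (hfj (ns n)).1.1) hf.1.1 ?_
      have e : ∀ n, eLpNorm (fj (ns n) - f) 1 (sphMeasure d) =
          ENNReal.ofReal (∫ ξ, |fj (ns n) ξ - f ξ| ∂(sphMeasure d)) := fun n => by
        rw [eLpNorm_one_eq_lintegral_enorm, ← ofReal_integral_norm_eq_lintegral_enorm ((hfj (ns n)).1.sub hf.1)]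
        rfl
      simp only [e]
      have := (ENNReal.continuous_ofReal.tendsto 0).comp (c1.comp hns)
      rw [ENNReal.ofReal_zero] at this
      exact this
    obtain ⟨ms', -, hms'⟩ := hm.exists_seq_tendsto_ae
    refine ⟨ms', ?_⟩
    have := tendsto_integral_of_dominated_convergence (μ := sphMeasure d)
      (F := fun n x => |Real.sign (fj (ns (ms' n)) x) - Real.sign (f x)| * ‖g x‖) (f := fun _ => 0)
      (fun x => 2 * ‖g x‖) (fun n => mm _) (hf.2.1.norm.const_mul 2)
      (fun n => Eventually.of_forall (bnd _)) (by
        filter_upwards [hms', (memW11_abs hf).1] with x hx hx2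
        by_cases h0 : f x = 0
        · simp [hx2 h0]
        · refine tendsto_const_nhds.congr' ?_
          rcases lt_or_gt_of_ne h0 with h0 | h0
          · filter_upwards [hx.eventually (gt_mem_nhds h0)] with n hn
            simp [Real.sign_of_neg h0, Real.sign_of_neg hn]
          · filter_upwards [hx.eventually (lt_mem_nhds h0)] with n hn
            simp [Real.sign_of_pos h0, Real.sign_of_pos hn])
    simpa using this
  unfold W11Tendsto
  have hsum := c1.add (c2.add c3)
  rw [add_zero, add_zero] at hsum
  refine squeeze_zero (fun j => add_nonneg (integral_nonneg fun _ => abs_nonneg _)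
    (integral_nonneg fun _ => norm_nonneg _)) (fun j => ?_) hsum
  refine add_le_add ?_ ?_
  · exact integral_mono (((hfj j).1.abs.sub hf.1.abs).abs) (((hfj j).1.sub hf.1).abs)
      fun x => abs_abs_sub_abs_le_abs_sub _ _
  · have ig : Integrable (fun x => ‖gj j x - g x‖) (sphMeasure d) := ((hfj j).2.1.sub hf.2.1).norm
    rw [← integral_add ig (ii j)]
    refine integral_mono (((memW11_abs (hfj j)).2.2.1.sub (memW11_abs hf).2.2.1).norm)
      (ig.add (ii j)) fun x => ?_
    have e : Real.sign (fj j x) • gj j x - Real.sign (f x) • g x =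
        Real.sign (fj j x) • (gj j x - g x) + (Real.sign (fj j x) - Real.sign (f x)) • g x := by
      rw [smul_sub, sub_smul]; abel
    simp only
    rw [e]
    refine (norm_add_le _ _).trans (add_le_add ?_ ?_)
    · rw [norm_smul]
      exact mul_le_of_le_one_left (norm_nonneg _) (sg _)
    · rw [norm_smul]; rfl


end

/-- If `f_j → f` in `W^{1,1}(𝕊^d)` then `|f_j| → |f|` in `W^{1,1}(𝕊^d)`. -/
theorem abs_convergence_W11 (d : ℕ) (hd : 1 ≤ d)
    (f : Sph d → ℝ) (g : Sph d → Euc (d + 1))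
    (fj : ℕ → Sph d → ℝ) (gj : ℕ → Sph d → Euc (d + 1))
    (hf : MemW11 f g) (hfj : ∀ j, MemW11 (fj j) (gj j))
    (hconv : W11Tendsto fj gj f g) :
    ∃ (h : Sph d → Euc (d + 1)) (hj : ℕ → Sph d → Euc (d + 1)),
      MemW11 (fun ξ => |f ξ|) h ∧ (∀ j, MemW11 (fun ξ => |fj j ξ|) (hj j)) ∧
      W11Tendsto (fun j ξ => |fj j ξ|) hj (fun ξ => |f ξ|) h := by
  exact ⟨fun x => Real.sign (f x) • g x, fun j x => Real.sign (fj j x) • gj j x,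
    (memW11_abs hf).2, fun j => (memW11_abs (hfj j)).2,
    abs_conv_main d f g fj gj hf hfj hconv⟩

end
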